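/- The real number φ² = (3+√5)/2 is a root of multiplicity exactly 1 of the characteristic polynomial of the matrix M (regarded over ℝ, or over ℂ), and every complex eigenvalue λ of M satisfies |λ| ≤ φ²; that is, φ² is the Perron–Frobenius eigenvalue of M and it is simple. -/

import Mathlib

/-- For each row index `i ∈ {1, …, 24}`, the set of (1-based) column indices of
the nonzero entries of the substitution matrix of the decorated
Fibonacci-product substitution `ω`. -/
def fibOmegaRowSet : ℕ → Finset ℕ
  | 1 => {5, 10, 16, 19}
  | 2 => {3, 5, 7, 21}
  | 3 => {2, 6, 20, 22}
  | 4 => {9, 13, 18, 20}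
  | 5 => {1, 8}
  | 6 => {3, 7}
  | 7 => {2, 6}
  | 8 => {5, 16}
  | 9 => {1}
  | 10 => {2}
  | 11 => {3}
  | 12 => {4}
  | 13 => {4, 7, 17, 22}
  | 14 => {9, 15, 17, 19}
  | 15 => {8, 10, 14, 18}
  | 16 => {1, 6, 8, 21}
  | 17 => {13, 20}
  | 18 => {15, 19}
  | 19 => {14, 18}
  | 20 => {4, 17}
  | 21 => {13}
  | 22 => {14}
  | 23 => {15}
  | 24 => {16}
  | _ => ∅

/-- The `24 × 24` zero-one substitution matrix `M` of the decorated
Fibonacci-product substitution `ω`, regarded as a complex matrix. -/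
def fibOmegaMatrixComplex : Matrix (Fin 24) (Fin 24) ℂ :=
  Matrix.of fun i j => if (j : ℕ) + 1 ∈ fibOmegaRowSet ((i : ℕ) + 1) then 1 else 0

namespace Matrix

variable {n : Type*} [Fintype n] {A : Matrix n n ℝ} {v : n → ℝ} {ρ : ℝ}

/-- The zero set of a nonnegative eigenvector is closed under following positive entries. -/
lemma eigenvector_eq_zero_of_entry_pos (hA : ∀ i j, 0 ≤ A i j) {y : n → ℝ} (hy : ∀ i, 0 ≤ y i)
    (hAy : A *ᵥ y = ρ • y) {i j : n} (hi : y i = 0) (hij : 0 < A i j) : y j = 0 := by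
  have hsum : ∑ k, A i k * y k = 0 := by
    simpa [mulVec, dotProduct, hi] using congrFun hAy i
  have hterm := (Finset.sum_eq_zero_iff_of_nonneg
    fun k _ => mul_nonneg (hA i k) (hy k)).1 hsum j (Finset.mem_univ j)
  exact (mul_eq_zero.1 hterm).resolve_left hij.ne'

/-- An eigenvector of a nonnegative matrix is a multiple of a positive one with the same
eigenvalue, provided that nonzero nonnegative eigenvectors have no zero coordinate. -/
lemma exists_eq_smul_of_mulVec_eq_smul [Nonempty n] (hv : ∀ i, 0 < v i) (hAv : A *ᵥ v = ρ • v)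
    (hzero : ∀ y : n → ℝ, (∀ i, 0 ≤ y i) → A *ᵥ y = ρ • y → (∃ i, y i = 0) → y = 0)
    {x : n → ℝ} (hx : A *ᵥ x = ρ • x) : ∃ t : ℝ, x = t • v := by
  obtain ⟨i, hi⟩ := Finite.exists_min fun i => x i / v i
  refine ⟨x i / v i, sub_eq_zero.1 (hzero _ (fun j => ?_) ?_ ⟨i, ?_⟩)⟩
  · simpa using (le_div_iff₀ (hv j)).1 (hi j)
  · rw [mulVec_sub, mulVec_smul, hx, hAv, smul_sub, smul_comm]
  · simp [(hv i).ne']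

lemma nonpos_of_mulVec_eq_smul_add [Nonempty n] (hA : ∀ i j, 0 ≤ A i j) (hv : ∀ i, 0 < v i)
    (hAv : A *ᵥ v = ρ • v) {x : n → ℝ} {s : ℝ} (hx : A *ᵥ x = ρ • x + s • v) : s ≤ 0 := by
  obtain ⟨i, hi⟩ := Finite.exists_max fun i => x i / v i
  have hle : (A *ᵥ x) i ≤ (A *ᵥ ((x i / v i) • v)) i :=
    Finset.sum_le_sum fun j _ =>
      mul_le_mul_of_nonneg_left (by simpa using (div_le_iff₀ (hv j)).1 (hi j)) (hA i j)
  have hcancel : x i / v i * (ρ * v i) = ρ * x i := by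
    have := (hv i).ne'
    field_simp
  rw [mulVec_smul, hx, hAv] at hle
  simp only [Pi.add_apply, Pi.smul_apply, smul_eq_mul, hcancel] at hle
  exact nonpos_of_mul_nonpos_left (by linarith) (hv i)

/-- A positive eigenvector of a nonnegative matrix has no generalized eigenvector of
higher order above it. -/
lemma eq_zero_of_mulVec_eq_smul_add [Nonempty n] (hA : ∀ i j, 0 ≤ A i j) (hv : ∀ i, 0 < v i)
    (hAv : A *ᵥ v = ρ • v) {x : n → ℝ} {s : ℝ} (hx : A *ᵥ x = ρ • x + s • v) : s = 0 := by
  refine le_antisymm (nonpos_of_mulVec_eq_smul_add hA hv hAv hx) (neg_nonpos.1 ?_)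
  refine nonpos_of_mulVec_eq_smul_add hA hv hAv (x := -x) ?_
  rw [mulVec_neg, hx, smul_neg, neg_smul, neg_add]

/-- Simplicity of the Perron eigenvalue of a nonnegative matrix with a positive eigenvector. -/
theorem rootMultiplicity_charpoly_eq_one [DecidableEq n] [Nonempty n] (hA : ∀ i j, 0 ≤ A i j)
    (hv : ∀ i, 0 < v i) (hAv : A *ᵥ v = ρ • v)
    (hzero : ∀ y : n → ℝ, (∀ i, 0 ≤ y i) → A *ᵥ y = ρ • y → (∃ i, y i = 0) → y = 0) :
    A.charpoly.rootMultiplicity ρ = 1 := by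
  have hv0 : v ≠ 0 := fun h => (hv (Classical.arbitrary n)).ne' (congrFun h _)
  set g : Module.End ℝ (n → ℝ) := toLin' A - ρ • 1 with hg
  have hg_apply (x : n → ℝ) : g x = A *ᵥ x - ρ • x := by simp [hg]
  have hker {x : n → ℝ} (hx : g x = 0) : ∃ t : ℝ, x = t • v :=
    exists_eq_smul_of_mulVec_eq_smul hv hAv hzero (sub_eq_zero.1 (hg_apply x ▸ hx))
  have hpow (k : ℕ) : ∀ x, (g ^ k) x = 0 → g x = 0 := by
    induction k with
    | zero => intro x hx; simp_all
    | succ k ih =>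
      intro x hx
      obtain ⟨s, hs⟩ := hker (ih (g x) (by rwa [pow_succ, Module.End.mul_apply] at hx))
      have hs0 : s = 0 := eq_zero_of_mulVec_eq_smul_add hA hv hAv (x := x)
        (by rw [← hs, hg_apply]; abel)
      rw [hs, hs0, zero_smul]
  have hspan : Module.End.maxGenEigenspace (toLin' A) ρ = Submodule.span ℝ {v} := by
    ext x
    rw [Module.End.mem_maxGenEigenspace, Submodule.mem_span_singleton]
    constructor
    · rintro ⟨k, hk⟩
      obtain ⟨t, ht⟩ := hker (hpow k x hk)
      exact ⟨t, ht.symm⟩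
    · rintro ⟨t, rfl⟩
      refine ⟨1, ?_⟩
      rw [pow_one, ← hg, hg_apply, mulVec_smul, hAv, smul_comm, sub_self]
  rw [← charpoly_toLin', ← LinearMap.finrank_maxGenEigenspace_eq, hspan,
    finrank_span_singleton hv0]

/-- A positive eigenvector of a nonnegative matrix belongs to the spectral radius. -/
theorem norm_le_of_isRoot_charpoly_map [DecidableEq n] (hA : ∀ i j, 0 ≤ A i j)
    (hv : ∀ i, 0 < v i) (hAv : A *ᵥ v = ρ • v) {μ : ℂ}
    (hμ : (A.map Complex.ofRealHom).charpoly.IsRoot μ) : ‖μ‖ ≤ ρ := by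
  rw [← charpoly_toLin', ← Module.End.hasEigenvalue_iff_isRoot_charpoly] at hμ
  obtain ⟨x, hx⟩ := hμ.exists_hasEigenvector
  have hAx : A.map Complex.ofRealHom *ᵥ x = μ • x := by
    simpa using hx.apply_eq_smul
  obtain ⟨k, hk⟩ := Function.ne_iff.1 hx.2
  have : Nonempty n := ⟨k⟩
  obtain ⟨i, hi⟩ := Finite.exists_max fun i => ‖x i‖ / v i
  have hxi : 0 < ‖x i‖ := by
    have := (div_pos (norm_pos_iff.2 hk) (hv k)).trans_le (hi k)
    exact (div_pos_iff_of_pos_right (hv i)).1 this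
  refine le_of_mul_le_mul_right ?_ hxi
  calc ‖μ‖ * ‖x i‖ = ‖∑ j, (A i j : ℂ) * x j‖ := by
        rw [← norm_mul, ← smul_eq_mul, ← Pi.smul_apply, ← hAx]
        simp [mulVec, dotProduct]
    _ ≤ ∑ j, A i j * (‖x i‖ / v i * v j) := by
        refine norm_sum_le_of_le _ fun j _ => ?_
        rw [norm_mul, Complex.norm_real, Real.norm_of_nonneg (hA i j)]
        exact mul_le_mul_of_nonneg_left ((div_le_iff₀ (hv j)).1 (hi j)) (hA i j)
    _ = ‖x i‖ / v i * (A *ᵥ v) i := by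
        simp only [mulVec, dotProduct, Finset.mul_sum]
        exact Finset.sum_congr rfl fun j _ => by ring
    _ = ρ * ‖x i‖ := by
        have := (hv i).ne'
        rw [hAv, Pi.smul_apply, smul_eq_mul]
        field_simp

end Matrix

/-- The substitution matrix `M` with real entries. -/
def fibOmegaMatrixReal : Matrix (Fin 24) (Fin 24) ℝ :=
  Matrix.of fun i j => if (j : ℕ) + 1 ∈ fibOmegaRowSet ((i : ℕ) + 1) then 1 else 0

lemma fibOmegaMatrixReal_map :
    fibOmegaMatrixReal.map Complex.ofRealHom = fibOmegaMatrixComplex := by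
  ext i j
  simp only [fibOmegaMatrixReal, fibOmegaMatrixComplex, Matrix.map_apply, Matrix.of_apply]
  split_ifs <;> simp

lemma fibOmegaMatrixReal_nonneg (i j : Fin 24) : 0 ≤ fibOmegaMatrixReal i j := by
  simp only [fibOmegaMatrixReal, Matrix.of_apply]
  split_ifs <;> simp

lemma fibOmegaMatrixReal_pos {i j : Fin 24}
    (h : (j : ℕ) + 1 ∈ fibOmegaRowSet ((i : ℕ) + 1)) : 0 < fibOmegaMatrixReal i j := by
  simp [fibOmegaMatrixReal, h]

/-- The tile volumes are `φ ^ e`, where `e = 2, 1, 1, 0` for tiles of type `A`, `B`, `C`, `D`. -/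
def fibOmegaVolumeExponent : Fin 24 → ℕ :=
  ![2, 2, 2, 2, 1, 1, 1, 1, 0, 0, 0, 0, 2, 2, 2, 2, 1, 1, 1, 1, 0, 0, 0, 0]

lemma fibOmegaMatrixReal_mulVec_volume :
    fibOmegaMatrixReal.mulVec (fun i => Real.goldenRatio ^ fibOmegaVolumeExponent i) =
      Real.goldenRatio ^ 2 • fun i => Real.goldenRatio ^ fibOmegaVolumeExponent i := by
  have h := Real.goldenRatio_sq
  ext i
  fin_cases i <;>
    simp [Matrix.mulVec, dotProduct, fibOmegaMatrixReal, fibOmegaRowSet, fibOmegaVolumeExponent,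
      Fin.sum_univ_succ] <;>
    grind

/-- The successor of each tile on a path to the first tile in the graph of `M`. -/
def fibOmegaTowardFirst : Fin 24 → Fin 24 :=
  ![0, 4, 1, 8, 0, 2, 1, 4, 0, 1, 2, 3, 3, 8, 7, 0, 12, 14, 13, 3, 12, 13, 14, 15]

/-- The predecessor of each tile on a path from the first tile in the graph of `M`; the tiles
that cannot be reached are sent to their unique successor. -/
def fibOmegaFromFirst : Fin 24 → Fin 24 :=
  ![0, 9, 1, 12, 0, 15, 1, 4, 13, 0, 2, 3, 20, 18, 13, 0, 13, 18, 0, 2, 15, 2, 14, 15]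

lemma fibOmega_eigenvector_eq_zero {ρ : ℝ} (hρ : ρ ≠ 0) {y : Fin 24 → ℝ} (hy : ∀ i, 0 ≤ y i)
    (hMy : fibOmegaMatrixReal.mulVec y = ρ • y) (hzero : ∃ i, y i = 0) : y = 0 := by
  have hstep {i j : Fin 24} (hij : (j : ℕ) + 1 ∈ fibOmegaRowSet ((i : ℕ) + 1)) (hi : y i = 0) :
      y j = 0 :=
    Matrix.eigenvector_eq_zero_of_entry_pos fibOmegaMatrixReal_nonneg hy hMy hi
      (fibOmegaMatrixReal_pos hij)
  have htoward (i : Fin 24) (hi : y i = 0) : y (fibOmegaTowardFirst i) = 0 := by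
    have hedge : ∀ i, fibOmegaTowardFirst i = i ∨
        (fibOmegaTowardFirst i : ℕ) + 1 ∈ fibOmegaRowSet ((i : ℕ) + 1) := by decide
    rcases hedge i with h | h
    · rwa [h]
    · exact hstep h hi
  have hfrom (i : Fin 24) (hi : y (fibOmegaFromFirst i) = 0) : y i = 0 := by
    have hedge : ∀ i, fibOmegaFromFirst i = i ∨
        (i : ℕ) + 1 ∈ fibOmegaRowSet ((fibOmegaFromFirst i : ℕ) + 1) ∨
        ∀ j : Fin 24, (j : ℕ) + 1 ∈ fibOmegaRowSet ((i : ℕ) + 1) → j = fibOmegaFromFirst i := by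
      decide
    rcases hedge i with h | h | h
    · rwa [h] at hi
    · exact hstep h hi
    · have hrow : ∑ j, fibOmegaMatrixReal i j * y j = ρ * y i := congrFun hMy i
      rw [Finset.sum_eq_zero fun j _ => ?_] at hrow
      · exact (mul_eq_zero.1 hrow.symm).resolve_left hρ
      · by_cases hj : (j : ℕ) + 1 ∈ fibOmegaRowSet ((i : ℕ) + 1)
        · rw [h j hj, hi, mul_zero]
        · simp [fibOmegaMatrixReal, hj]
  have htoward_iterate (k : ℕ) : ∀ i, y i = 0 → y (fibOmegaTowardFirst^[k] i) = 0 := by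
    induction k with
    | zero => exact fun i hi => hi
    | succ k ih => exact fun i hi => ih _ (htoward i hi)
  have hfrom_iterate (k : ℕ) : ∀ i, y (fibOmegaFromFirst^[k] i) = 0 → y i = 0 := by
    induction k with
    | zero => exact fun i hi => hi
    | succ k ih => exact fun i hi => hfrom i (ih _ hi)
  have htoward_first : ∀ i, fibOmegaTowardFirst^[4] i = 0 := by decide
  have hfrom_first : ∀ i, fibOmegaFromFirst^[5] i = 0 := by decide
  obtain ⟨i, hi⟩ := hzero
  have hfirst : y 0 = 0 := htoward_first i ▸ htoward_iterate 4 i hi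
  funext j
  exact hfrom_iterate 5 j ((hfrom_first j).symm ▸ hfirst)

/-- `φ² = (3 + √5)/2` is a root of multiplicity exactly `1`
of the characteristic polynomial of the substitution matrix `M`, and every
complex eigenvalue `λ` of `M` satisfies `|λ| ≤ φ²`; i.e. `φ²` is the
Perron–Frobenius eigenvalue of `M` and it is simple. -/
theorem goldenRatio_sq_is_simple_perron_eigenvalue :
    Polynomial.rootMultiplicity ((((3 + Real.sqrt 5) / 2 : ℝ) : ℂ))
      fibOmegaMatrixComplex.charpoly = 1 ∧
    ∀ lam : ℂ, fibOmegaMatrixComplex.charpoly.IsRoot lam →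
      ‖lam‖ ≤ (3 + Real.sqrt 5) / 2 := by
  have hv (i : Fin 24) : 0 < Real.goldenRatio ^ fibOmegaVolumeExponent i :=
    pow_pos Real.goldenRatio_pos _
  have hsq : (3 + Real.sqrt 5) / 2 = Real.goldenRatio ^ 2 := by
    rw [Real.goldenRatio_sq, Real.goldenRatio]
    ring
  rw [hsq, ← fibOmegaMatrixReal_map]
  refine ⟨?_, fun lam => Matrix.norm_le_of_isRoot_charpoly_map fibOmegaMatrixReal_nonneg hv
    fibOmegaMatrixReal_mulVec_volume⟩
  rw [Matrix.charpoly_map, ← Complex.ofRealHom_eq_coe,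
    ← Polynomial.eq_rootMultiplicity_map Complex.ofRealHom.injective]
  exact Matrix.rootMultiplicity_charpoly_eq_one fibOmegaMatrixReal_nonneg hv
    fibOmegaMatrixReal_mulVec_volume fun y =>
      fibOmega_eigenvector_eq_zero (pow_ne_zero 2 Real.goldenRatio_ne_zero)
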